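/- Assume h₁/μ₁ ≤ h₂/μ₂. Fix ℓ with 0 ≤ ℓ ≤ C₁ − 1 and k = C₁ − ℓ. If μ₁ < μ₂ and ℓ < C₂, then the set {i ∈ ℤ≥0 : D(i,k,ℓ) > 0} is nonempty, and its least element ĩ_D(ℓ) satisfies ⌊R₁⌋ + 1 ≤ ĩ_D(ℓ) ≤ ⌊R₁⌋ + 1 + (C₁ − 1), where R₁ = −b/c (a nonnegative real number, since b ≤ 0 and c > 0 under these hypotheses). Otherwise (that is, if μ₁ ≥ μ₂, or if ℓ ≥ C₂), D(i,k,ℓ) ≤ 0 for all i ≥ 0. -/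

import Mathlib

/-- Overall service rate `d(k,ℓ) = k·μ₁ + min(ℓ,C₂)·μ₂`. -/
noncomputable def dRate (C₂ : ℕ) (μ₁ μ₂ : ℝ) (k ℓ : ℕ) : ℝ :=
  (k : ℝ) * μ₁ + ((min ℓ C₂ : ℕ) : ℝ) * μ₂

/-- Membership of `(i,k,ℓ)` in the state space `X`. -/
def memX (C₁ : ℕ) (i k ℓ : ℕ) : Prop :=
  (i = 0 ∧ k + ℓ < C₁) ∨ k + ℓ = C₁

/-- `v` satisfies the optimality (Bellman) equations of the clearing system.
Terms whose coefficient `k·μ₁` or `min(ℓ,C₂)·μ₂` vanishes contribute `0`,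
matching the convention that such summands are omitted. -/
def IsValue (C₁ C₂ : ℕ) (μ₁ μ₂ h₀ h₁ h₂ : ℝ) (v : ℕ → ℕ → ℕ → ℝ) : Prop :=
  v 0 0 0 = 0 ∧
  (∀ k ℓ : ℕ, k + ℓ ≤ C₁ → ¬(k = 0 ∧ ℓ = 0) →
    v 0 k ℓ = ((k : ℝ) * h₁ + (ℓ : ℝ) * h₂) / dRate C₂ μ₁ μ₂ k ℓ
      + ((k : ℝ) * μ₁ / dRate C₂ μ₁ μ₂ k ℓ) * v 0 (k - 1) ℓ
      + (((min ℓ C₂ : ℕ) : ℝ) * μ₂ / dRate C₂ μ₁ μ₂ k ℓ) * v 0 k (ℓ - 1)) ∧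
  (∀ i k ℓ : ℕ, k + ℓ = C₁ →
    v (i + 1) k ℓ =
      (((i : ℝ) + 1) * h₀ + (k : ℝ) * h₁ + (ℓ : ℝ) * h₂) / dRate C₂ μ₁ μ₂ k ℓ
      + ((k : ℝ) * μ₁ / dRate C₂ μ₁ μ₂ k ℓ) *
          min (v i k ℓ) (v i (k - 1) (ℓ + 1))
      + (((min ℓ C₂ : ℕ) : ℝ) * μ₂ / dRate C₂ μ₁ μ₂ k ℓ) *
          min (v i (k + 1) (ℓ - 1)) (v i k ℓ))

/-- The difference `D(i,k,ℓ) = v(i,k,ℓ) − v(i,k−1,ℓ+1)`. -/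
noncomputable def Dv (v : ℕ → ℕ → ℕ → ℝ) (i k ℓ : ℕ) : ℝ :=
  v i k ℓ - v i (k - 1) (ℓ + 1)

/-- Multiplied-out recursion along the full-occupancy states. -/
def RecV (N C₂ : ℕ) (μ₁ μ₂ h₀ h₁ h₂ : ℝ) (V : ℕ → ℕ → ℝ) : Prop :=
  ∀ i ℓ : ℕ, ℓ ≤ N →
    (((N : ℝ) - ℓ) * μ₁ + ((min ℓ C₂ : ℕ) : ℝ) * μ₂) * V (i + 1) ℓ =
      ((i : ℝ) + 1) * h₀ + ((N : ℝ) - ℓ) * h₁ + ℓ * h₂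
      + ((N : ℝ) - ℓ) * μ₁ * min (V i ℓ) (V i (ℓ + 1))
      + ((min ℓ C₂ : ℕ) : ℝ) * μ₂ * min (V i (ℓ - 1)) (V i ℓ)

lemma dRate_pos {C₂ : ℕ} (hC₂pos : 1 ≤ C₂) {μ₁ μ₂ : ℝ} (hμ₁ : 0 < μ₁) (hμ₂ : 0 < μ₂)
    (k ℓ : ℕ) (h : ¬(k = 0 ∧ ℓ = 0)) : 0 < dRate C₂ μ₁ μ₂ k ℓ := by
  unfold dRate
  rcases Nat.eq_zero_or_pos k with rfl | hk
  · have h1 : 0 < min ℓ C₂ := by omega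
    have : (0 : ℝ) < ((min ℓ C₂ : ℕ) : ℝ) := by exact_mod_cast h1
    simp only [Nat.cast_zero, zero_mul, zero_add]
    positivity
  · have : (0 : ℝ) < (k : ℝ) := by exact_mod_cast hk
    positivity

/-- Cost of clearing `ℓ` jobs of station 2. -/
noncomputable def gCost (C₂ : ℕ) (μ₂ h₂ : ℝ) : ℕ → ℝ
  | 0 => 0
  | n + 1 => gCost C₂ μ₂ h₂ n + ((n : ℝ) + 1) * h₂ / (((min (n + 1) C₂ : ℕ) : ℝ) * μ₂)

lemma v_zero {C₁ C₂ : ℕ} (hC₂pos : 1 ≤ C₂) {μ₁ μ₂ h₀ h₁ h₂ : ℝ} (hμ₁ : 0 < μ₁) (hμ₂ : 0 < μ₂)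
    {v : ℕ → ℕ → ℕ → ℝ} (hv : IsValue C₁ C₂ μ₁ μ₂ h₀ h₁ h₂ v) :
    ∀ n k ℓ : ℕ, k + ℓ = n → n ≤ C₁ → v 0 k ℓ = k * (h₁ / μ₁) + gCost C₂ μ₂ h₂ ℓ := by
  intro n
  induction n with
  | zero =>
    intro k ℓ h _
    obtain ⟨rfl, rfl⟩ : k = 0 ∧ ℓ = 0 := by omega
    simp [hv.1, gCost]
  | succ n ih =>
    intro k ℓ h hn
    have hne : ¬(k = 0 ∧ ℓ = 0) := by omega
    have hd := dRate_pos hC₂pos hμ₁ hμ₂ k ℓ hne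
    rw [hv.2.1 k ℓ (by omega) hne]
    have e1 : (k : ℝ) * v 0 (k - 1) ℓ
        = k * ((k - 1) * (h₁ / μ₁) + gCost C₂ μ₂ h₂ ℓ) := by
      rcases Nat.eq_zero_or_pos k with rfl | hk
      · simp
      · rw [ih (k - 1) ℓ (by omega) (by omega), Nat.cast_sub hk]; simp
    have e2 : ((min ℓ C₂ : ℕ) : ℝ) * μ₂ * v 0 k (ℓ - 1)
        = ((min ℓ C₂ : ℕ) : ℝ) * μ₂ * (k * (h₁ / μ₁) + gCost C₂ μ₂ h₂ ℓ) - ℓ * h₂ := by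
      rcases ℓ with _ | m
      · simp
      · rw [Nat.add_sub_cancel, ih k m (by omega) (by omega)]
        have h1 : 0 < min (m + 1) C₂ := by omega
        have h2 : (0 : ℝ) < ((min (m + 1) C₂ : ℕ) : ℝ) := by exact_mod_cast h1
        have h3 : ((min (m + 1) C₂ : ℕ) : ℝ) * μ₂ *
          (((m : ℝ) + 1) * h₂ / (((min (m + 1) C₂ : ℕ) : ℝ) * μ₂)) = ((m : ℝ) + 1) * h₂ := by
          field_simp
        simp only [gCost]
        push_cast at h3 ⊢
        linarith
    have e3 : (k : ℝ) * h₁ = k * μ₁ * (h₁ / μ₁) := by field_simp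
    have : (↑k * h₁ + ↑ℓ * h₂) / dRate C₂ μ₁ μ₂ k ℓ + ↑k * μ₁ / dRate C₂ μ₁ μ₂ k ℓ * v 0 (k - 1) ℓ +
      ((min ℓ C₂ : ℕ) : ℝ) * μ₂ / dRate C₂ μ₁ μ₂ k ℓ * v 0 k (ℓ - 1)
      = (↑k * h₁ + ↑ℓ * h₂ + μ₁ * (k * v 0 (k - 1) ℓ) + ((min ℓ C₂ : ℕ) : ℝ) * μ₂ * v 0 k (ℓ - 1))
        / dRate C₂ μ₁ μ₂ k ℓ := by ring
    rw [this, div_eq_iff hd.ne', e1, e2, e3]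
    unfold dRate
    ring

lemma gCost_step {C₂ : ℕ} (hC₂pos : 1 ≤ C₂) {μ₂ h₂ : ℝ} (hμ₂ : 0 < μ₂) (hh₂ : 0 < h₂) (ℓ : ℕ) :
    h₂ / μ₂ ≤ gCost C₂ μ₂ h₂ (ℓ + 1) - gCost C₂ μ₂ h₂ ℓ := by
  simp only [gCost]
  have h1 : 0 < min (ℓ + 1) C₂ := by omega
  have h2 : (0 : ℝ) < ((min (ℓ + 1) C₂ : ℕ) : ℝ) := by exact_mod_cast h1
  have h3 : ((min (ℓ + 1) C₂ : ℕ) : ℝ) ≤ (ℓ : ℝ) + 1 := by exact_mod_cast min_le_left _ _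
  rw [add_sub_cancel_left, div_le_div_iff₀ hμ₂ (by positivity)]
  have := mul_le_mul_of_nonneg_right h3 (mul_pos hμ₂ hh₂).le
  nlinarith

lemma gCost_step_eq {C₂ : ℕ} {μ₂ h₂ : ℝ} (hμ₂ : 0 < μ₂) (ℓ : ℕ) (hl : ℓ < C₂) :
    gCost C₂ μ₂ h₂ (ℓ + 1) - gCost C₂ μ₂ h₂ ℓ = h₂ / μ₂ := by
  simp only [gCost]
  rw [min_eq_left (by omega)]
  push_cast
  have : (0 : ℝ) < (ℓ : ℝ) + 1 := by positivity
  field_simp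
  ring

lemma recV_of {C₁ C₂ : ℕ} (hC₂pos : 1 ≤ C₂) (hC : C₂ < C₁) {μ₁ μ₂ h₀ h₁ h₂ : ℝ}
    (hμ₁ : 0 < μ₁) (hμ₂ : 0 < μ₂)
    {v : ℕ → ℕ → ℕ → ℝ} (hv : IsValue C₁ C₂ μ₁ μ₂ h₀ h₁ h₂ v) :
    RecV C₁ C₂ μ₁ μ₂ h₀ h₁ h₂ (fun i ℓ => v i (C₁ - ℓ) ℓ) := by
  intro i ℓ hl
  have hd := dRate_pos hC₂pos hμ₁ hμ₂ (C₁ - ℓ) ℓ (by omega)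
  have hr := hv.2.2 i (C₁ - ℓ) ℓ (by omega)
  have ek : ((C₁ - ℓ : ℕ) : ℝ) = (C₁ : ℝ) - ℓ := Nat.cast_sub hl
  have ed : ((C₁ : ℝ) - ℓ) * μ₁ + ((min ℓ C₂ : ℕ) : ℝ) * μ₂ = dRate C₂ μ₁ μ₂ (C₁ - ℓ) ℓ := by
    unfold dRate; rw [ek]
  have e1 : C₁ - ℓ - 1 = C₁ - (ℓ + 1) := by omega
  have e2 : ((min ℓ C₂ : ℕ) : ℝ) * μ₂ * min (v i (C₁ - ℓ + 1) (ℓ - 1)) (v i (C₁ - ℓ) ℓ)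
      = ((min ℓ C₂ : ℕ) : ℝ) * μ₂ * min (v i (C₁ - (ℓ - 1)) (ℓ - 1)) (v i (C₁ - ℓ) ℓ) := by
    rcases ℓ with _ | m
    · simp
    · rw [show C₁ - (m + 1) + 1 = C₁ - (m + 1 - 1) by omega]
  simp only
  rw [ed, hr, ← e2, e1, ek]
  field_simp

lemma V_incr {N C₂ : ℕ} (hC₂pos : 1 ≤ C₂) (hC : C₂ < N) {μ₁ μ₂ h₀ h₁ h₂ : ℝ}
    (hμ₁ : 0 < μ₁) (hμ₂ : 0 < μ₂) (hh₀ : 0 < h₀)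
    {V : ℕ → ℕ → ℝ} (hV : RecV N C₂ μ₁ μ₂ h₀ h₁ h₂ V)
    (a : ℝ)
    (hbase : ∀ ℓ ≤ N, V 0 ℓ + a ≤ V 1 ℓ) :
    ∀ i ℓ, ℓ ≤ N → V i ℓ + a ≤ V (i + 1) ℓ := by
  intro i
  induction i with
  | zero => simpa using hbase
  | succ i ih =>
    intro ℓ hl
    have r1 := hV i ℓ hl
    have r2 := hV (i + 1) ℓ hl
    have hk : (0 : ℝ) ≤ (N : ℝ) - ℓ := by
      have : (ℓ : ℝ) ≤ N := by exact_mod_cast hl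
      linarith
    have hd := dRate_pos hC₂pos hμ₁ hμ₂ (N - ℓ) ℓ (by omega)
    unfold dRate at hd
    rw [Nat.cast_sub hl] at hd
    have m1 : ((N : ℝ) - ℓ) * μ₁ * (min (V i ℓ) (V i (ℓ + 1)) + a)
        ≤ ((N : ℝ) - ℓ) * μ₁ * min (V (i + 1) ℓ) (V (i + 1) (ℓ + 1)) := by
      rcases Nat.lt_or_ge ℓ N with h | h
      · apply mul_le_mul_of_nonneg_left _ (by positivity)
        rw [← min_add_add_right]
        exact min_le_min (ih ℓ hl) (ih (ℓ + 1) h)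
      · have : ℓ = N := by omega
        subst this; simp
    have m2 : ((min ℓ C₂ : ℕ) : ℝ) * μ₂ * (min (V i (ℓ - 1)) (V i ℓ) + a)
        ≤ ((min ℓ C₂ : ℕ) : ℝ) * μ₂ * min (V (i + 1) (ℓ - 1)) (V (i + 1) ℓ) := by
      apply mul_le_mul_of_nonneg_left _ (by positivity)
      rw [← min_add_add_right]
      exact min_le_min (ih (ℓ - 1) (by omega)) (ih ℓ hl)
    refine le_of_mul_le_mul_left ?_ hd
    rw [r2, mul_add, r1]
    push_cast at m2 ⊢
    linarith

lemma D_high {N C₂ : ℕ} (hC₂pos : 1 ≤ C₂) (hC : C₂ < N) {μ₁ μ₂ h₀ h₁ h₂ : ℝ}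
    (hμ₁ : 0 < μ₁) (hμ₂ : 0 < μ₂) (hh₂ : 0 < h₂)
    {V : ℕ → ℕ → ℝ} (hV : RecV N C₂ μ₁ μ₂ h₀ h₁ h₂ V)
    (hinc : ∀ i ℓ, ℓ ≤ N → V i ℓ + h₁ / μ₁ ≤ V (i + 1) ℓ)
    (h0 : ∀ ℓ < N, V 0 ℓ ≤ V 0 (ℓ + 1)) :
    ∀ i ℓ, C₂ ≤ ℓ → ℓ < N → V i ℓ ≤ V i (ℓ + 1) := by
  intro i
  induction i with
  | zero => intro ℓ _ h; exact h0 ℓ h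
  | succ i ih =>
    intro ℓ hl hN
    have r1 := hV i ℓ hN.le
    have r2 := hV i (ℓ + 1) hN
    rw [min_eq_right hl] at r1
    rw [min_eq_right (by omega : C₂ ≤ ℓ + 1)] at r2
    have hk : (0 : ℝ) ≤ (N : ℝ) - ℓ - 1 := by
      have : ((ℓ + 1 : ℕ) : ℝ) ≤ N := by exact_mod_cast hN
      push_cast at this
      linarith
    have hc : (0 : ℝ) < C₂ := by exact_mod_cast hC₂pos
    have i1 := ih ℓ hl hN
    rw [min_eq_left i1] at r1
    rw [Nat.add_sub_cancel, min_eq_left i1] at r2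
    have m2 : (C₂ : ℝ) * μ₂ * min (V i (ℓ - 1)) (V i ℓ) ≤ C₂ * μ₂ * V i ℓ :=
      mul_le_mul_of_nonneg_left (min_le_right _ _) (by positivity)
    have m1 : ((N : ℝ) - ℓ - 1) * μ₁ * V i ℓ
        ≤ ((N : ℝ) - ℓ - 1) * μ₁ * min (V i (ℓ + 1)) (V i (ℓ + 1 + 1)) := by
      rcases Nat.lt_or_ge (ℓ + 1) N with h | h
      · apply mul_le_mul_of_nonneg_left _ (by positivity)
        exact le_min i1 (i1.trans (ih (ℓ + 1) (by omega) h))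
      · have : N = ℓ + 1 := by omega
        subst this; simp
    have m3 := hinc i (ℓ + 1) hN
    have m4 : μ₁ * V i ℓ + h₁ ≤ μ₁ * V (i + 1) (ℓ + 1) := by
      have : μ₁ * (V i ℓ + h₁ / μ₁) ≤ μ₁ * V (i + 1) (ℓ + 1) :=
        mul_le_mul_of_nonneg_left (by linarith) hμ₁.le
      rwa [mul_add, mul_div_cancel₀ _ hμ₁.ne'] at this
    have hd : 0 < ((N : ℝ) - ℓ) * μ₁ + (C₂ : ℝ) * μ₂ := by
      have : 0 ≤ ((N : ℝ) - ℓ) * μ₁ := mul_nonneg (by linarith) hμ₁.le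
      have : 0 < (C₂ : ℝ) * μ₂ := by positivity
      linarith
    refine le_of_mul_le_mul_left ?_ hd
    push_cast at r2
    nlinarith

/-- Exact recursion of the differences for `ℓ < C₂`. -/
lemma D_rec {N C₂ : ℕ} (hC : C₂ < N) {μ₁ μ₂ h₀ h₁ h₂ : ℝ}
    (hμ₁ : 0 < μ₁) (hμ₂ : 0 < μ₂)
    {V : ℕ → ℕ → ℝ} (hV : RecV N C₂ μ₁ μ₂ h₀ h₁ h₂ V)
    (i ℓ : ℕ) (hl : ℓ < C₂) (d d' : ℝ) (hd : d = ((N : ℝ) - ℓ) * μ₁ + ℓ * μ₂)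
    (hd' : d' = ((N : ℝ) - ℓ - 1) * μ₁ + (ℓ + 1) * μ₂) :
    d * d' * (V (i + 1) ℓ - V (i + 1) (ℓ + 1)) =
      N * μ₁ * μ₂ * ((h₁ / μ₁ - h₂ / μ₂) + (h₀ / N * (1 / μ₁ - 1 / μ₂)) * ((i : ℝ) + 1))
      + d' * ℓ * μ₂ * (min (V i (ℓ - 1)) (V i ℓ) - min (V i ℓ) (V i (ℓ + 1)))
      + d * ((N : ℝ) - ℓ - 1) * μ₁ *
        (min (V i ℓ) (V i (ℓ + 1)) - min (V i (ℓ + 1)) (V i (ℓ + 1 + 1))) := by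
  have r1 := hV i ℓ (by omega)
  have r2 := hV i (ℓ + 1) (by omega)
  rw [min_eq_left hl.le, ← hd] at r1
  rw [min_eq_left (by omega : ℓ + 1 ≤ C₂), Nat.add_sub_cancel] at r2
  push_cast at r2
  rw [show ((N : ℝ) - (ℓ + 1)) = (N : ℝ) - ℓ - 1 by ring, ← hd'] at r2
  have hN : (0 : ℝ) < N := by exact_mod_cast (by omega : 0 < N)
  have e : N * μ₁ * μ₂ * ((h₁ / μ₁ - h₂ / μ₂) + (h₀ / N * (1 / μ₁ - 1 / μ₂)) * ((i : ℝ) + 1))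
      = N * (h₁ * μ₂ - h₂ * μ₁) + (μ₂ - μ₁) * h₀ * (i + 1) := by
    field_simp
  rw [e]
  have : d * d' * (V (i + 1) ℓ - V (i + 1) (ℓ + 1))
    = d' * (d * V (i + 1) ℓ) - d * (d' * V (i + 1) (ℓ + 1)) := by ring
  rw [this, r1, r2, hd, hd']
  ring

lemma D_nonpos {N C₂ : ℕ} (hC : C₂ < N) {μ₁ μ₂ h₀ h₁ h₂ : ℝ}
    (hμ₁ : 0 < μ₁) (hμ₂ : 0 < μ₂)
    {V : ℕ → ℕ → ℝ} (hV : RecV N C₂ μ₁ μ₂ h₀ h₁ h₂ V)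
    (hhigh : ∀ i ℓ, C₂ ≤ ℓ → ℓ < N → V i ℓ ≤ V i (ℓ + 1))
    (h0 : ∀ ℓ < N, V 0 ℓ ≤ V 0 (ℓ + 1)) :
    ∀ i : ℕ, (∀ j ≤ i, (h₁ / μ₁ - h₂ / μ₂) + (h₀ / N * (1 / μ₁ - 1 / μ₂)) * (j : ℝ) ≤ 0) →
      ∀ ℓ, ℓ < N → V i ℓ ≤ V i (ℓ + 1) := by
  intro i
  induction i with
  | zero => intro _; exact h0
  | succ i ih =>
    intro hx ℓ hN
    rcases Nat.lt_or_ge ℓ C₂ with hl | hl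
    swap
    · exact hhigh _ _ hl hN
    have ih' := ih (fun j hj => hx j (by omega))
    have hr := D_rec hC hμ₁ hμ₂ hV i ℓ hl _ _ rfl rfl
    have hk : (0 : ℝ) ≤ (N : ℝ) - ℓ - 1 := by
      have : ((ℓ + 1 : ℕ) : ℝ) ≤ N := by exact_mod_cast hN
      push_cast at this
      linarith
    have hx' := hx (i + 1) le_rfl
    push_cast at hx'
    have dp : 0 < ((N : ℝ) - ℓ) * μ₁ + ℓ * μ₂ := by
      have : 0 < ((N : ℝ) - ℓ) * μ₁ := mul_pos (by linarith) hμ₁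
      positivity
    have dp' : 0 < ((N : ℝ) - ℓ - 1) * μ₁ + (ℓ + 1) * μ₂ := by positivity
    have t1 : N * μ₁ * μ₂ * ((h₁ / μ₁ - h₂ / μ₂) + (h₀ / N * (1 / μ₁ - 1 / μ₂)) * ((i : ℝ) + 1)) ≤ 0 :=
      mul_nonpos_of_nonneg_of_nonpos (by positivity) hx'
    have i1 := ih' ℓ hN
    have i2 := ih' (ℓ + 1) (by omega)
    rw [min_eq_left i1, min_eq_left i2] at hr
    have t2 := mul_nonpos_of_nonneg_of_nonpos
      (a := (((N : ℝ) - ℓ - 1) * μ₁ + (ℓ + 1) * μ₂) * ℓ * μ₂) (by positivity)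
      (sub_nonpos.2 (min_le_right (V i (ℓ - 1)) (V i ℓ)))
    have t3 := mul_nonpos_of_nonneg_of_nonpos
      (a := (((N : ℝ) - ℓ) * μ₁ + ℓ * μ₂) * ((N : ℝ) - ℓ - 1) * μ₁) (by positivity)
      (sub_nonpos.2 i1)
    by_contra hcon
    push Not at hcon
    have := mul_pos (mul_pos dp dp') (sub_pos.2 hcon)
    linarith

/-- `min(a,b) - min(b,c) ≥ min(a-b,0)`. -/
lemma min_diff (a b c y : ℝ) (hy : y ≤ 0) (h : y ≤ a - b) : y ≤ min a b - min b c := by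
  have h1 : min b c ≤ b := min_le_left _ _
  have h2 : b + y ≤ min a b := le_min (by linarith) (by linarith)
  linarith

/-- Lag of the differences behind `b + c i`. -/
noncomputable def lag (N : ℕ) (μ₁ μ₂ c : ℝ) (ℓ : ℕ) : ℝ :=
  c * (ℓ * μ₂ + ((N : ℝ) - ℓ - 1) * μ₁) / μ₂

lemma D_lower {N C₂ : ℕ} (hC : C₂ < N) {μ₁ μ₂ h₀ h₁ h₂ : ℝ}
    (hμ₁ : 0 < μ₁) (hμ₂ : 0 < μ₂) (hlt : μ₁ < μ₂)
    {V : ℕ → ℕ → ℝ} (hV : RecV N C₂ μ₁ μ₂ h₀ h₁ h₂ V) (b c : ℝ)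
    (hb : b = h₁ / μ₁ - h₂ / μ₂) (hc : c = h₀ / N * (1 / μ₁ - 1 / μ₂))
    (hb0 : b ≤ 0) (hc0 : 0 < c)
    (h0 : ∀ ℓ < C₂, V 0 ℓ - V 0 (ℓ + 1) = b) :
    ∀ i ℓ : ℕ, ℓ < C₂ →
      (b + c * i ≤ lag N μ₁ μ₂ c ℓ → b + c * i - lag N μ₁ μ₂ c ℓ ≤ V i ℓ - V i (ℓ + 1)) ∧
      (lag N μ₁ μ₂ c ℓ < b + c * i → 0 < V i ℓ - V i (ℓ + 1)) := by
  have hlag0 : ∀ ℓ < C₂, 0 ≤ lag N μ₁ μ₂ c ℓ := by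
    intro ℓ hl
    have hk : (0 : ℝ) ≤ (N : ℝ) - ℓ - 1 := by
      have : ((ℓ + 1 : ℕ) : ℝ) ≤ N := by exact_mod_cast (by omega)
      push_cast at this
      linarith
    unfold lag
    positivity
  intro i
  induction i with
  | zero =>
    intro ℓ hl
    have := hlag0 ℓ hl
    rw [h0 ℓ hl]
    simp only [Nat.cast_zero, mul_zero, add_zero]
    exact ⟨fun _ => by linarith, fun h => by linarith⟩
  | succ i ih =>
    intro ℓ hl
    obtain ⟨d, hd⟩ : ∃ d, d = ((N : ℝ) - ℓ) * μ₁ + ℓ * μ₂ := ⟨_, rfl⟩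
    obtain ⟨d', hd'⟩ : ∃ d', d' = ((N : ℝ) - ℓ - 1) * μ₁ + (ℓ + 1) * μ₂ := ⟨_, rfl⟩
    have hr := D_rec hC hμ₁ hμ₂ hV i ℓ hl d d' hd hd'
    rw [← hb, ← hc] at hr
    have hk : (0 : ℝ) < (N : ℝ) - ℓ - 1 := by
      have : ((ℓ + 1 : ℕ) : ℝ) < N := by exact_mod_cast (by omega)
      push_cast at this
      linarith
    have hN : (0 : ℝ) < N := by exact_mod_cast (by omega : 0 < N)
    have dp : 0 < d := by
      have : 0 < ((N : ℝ) - ℓ) * μ₁ := mul_pos (by linarith) hμ₁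
      rw [hd]; positivity
    have dp' : 0 < d' := by rw [hd']; positivity
    have dd := mul_pos dp dp'
    obtain ⟨x, hx⟩ : ∃ x, x = b + c * (i : ℝ) := ⟨_, rfl⟩
    have hx1 : b + c * ((i : ℝ) + 1) = x + c := by rw [hx]; ring
    push_cast
    rw [hx1] at hr ⊢
    rw [← hx] at ih
    obtain ⟨L, hL⟩ : ∃ L, L = lag N μ₁ μ₂ c ℓ := ⟨_, rfl⟩
    have hL0 : 0 ≤ L := hL ▸ hlag0 ℓ hl
    rw [← hL]
    obtain ⟨q, hq⟩ : ∃ q, q = L + c * μ₁ / μ₂ := ⟨_, rfl⟩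
    have hLm : L * μ₂ = c * (ℓ * μ₂ + ((N : ℝ) - ℓ - 1) * μ₁) := by
      rw [hL]; unfold lag; field_simp
    have hqm : q * μ₂ = c * d := by
      rw [hq, add_mul, hLm, hd]; field_simp; ring
    have hqL : L < q := by rw [hq]; have : 0 < c * μ₁ / μ₂ := by positivity
                           linarith
    have hqL' : q < L + c := by
      have : (q - L - c) * μ₂ < 0 := by
        have : (q - L - c) * μ₂ = c * (μ₁ - μ₂) := by
          rw [sub_mul, sub_mul, hqm, hLm, hd]; ring
        rw [this]; exact mul_neg_of_pos_of_neg hc0 (by linarith)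
      have := neg_of_mul_neg_left this hμ₂.le
      linarith
    have hlagm : 1 ≤ ℓ → lag N μ₁ μ₂ c (ℓ - 1) = q - c := by
      intro h1
      have : lag N μ₁ μ₂ c (ℓ - 1) * μ₂ = (q - c) * μ₂ := by
        unfold lag
        rw [sub_mul q c, hqm, hd, Nat.cast_sub h1]
        field_simp
        push_cast
        ring
      exact mul_right_cancel₀ hμ₂.ne' this
    have hex : d * d' * (x + c - L) = N * μ₁ * μ₂ * (x + c) + d' * ℓ * μ₂ * (x + c - q)
        + d * ((N : ℝ) - ℓ - 1) * μ₁ * (x - L) := by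
      have e1 : d' * ℓ * μ₂ * (x + c - q) = d' * ℓ * (μ₂ * (x + c) - c * d) := by
        rw [← hqm]; ring
      have e2 : d * d' * L = d * ((N : ℝ) - ℓ - 1) * μ₁ * L + d * (ℓ + 1) * (L * μ₂) := by
        rw [hd']; ring
      have : d * d' * (x + c - L) = d * d' * (x + c) - d * d' * L := by ring
      rw [this, e1, e2, hLm]
      have : d * ((N : ℝ) - ℓ - 1) * μ₁ * (x - L) =
        d * ((N : ℝ) - ℓ - 1) * μ₁ * x - d * ((N : ℝ) - ℓ - 1) * μ₁ * L := by ring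
      rw [this, hd', hd]
      ring
    have c2 : 0 ≤ d' * ℓ * μ₂ := by positivity
    have c3 : 0 < d * ((N : ℝ) - ℓ - 1) * μ₁ := by positivity
    have c1 : 0 < N * μ₁ * μ₂ := by positivity
    obtain ⟨ihA, ihB⟩ := ih ℓ hl
    rw [← hL] at ihA ihB
    by_cases hA : x ≤ L ∧ (ℓ = 0 ∨ x + c ≤ q)
    · obtain ⟨hA1, hA2⟩ := hA
      have t3 : d * ((N : ℝ) - ℓ - 1) * μ₁ * (x - L) ≤ d * ((N : ℝ) - ℓ - 1) * μ₁ *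
          (min (V i ℓ) (V i (ℓ + 1)) - min (V i (ℓ + 1)) (V i (ℓ + 1 + 1))) :=
        mul_le_mul_of_nonneg_left (min_diff _ _ _ _ (by linarith) (ihA hA1)) c3.le
      have t2 : d' * ℓ * μ₂ * (x + c - q) ≤
          d' * ℓ * μ₂ * (min (V i (ℓ - 1)) (V i ℓ) - min (V i ℓ) (V i (ℓ + 1))) := by
        rcases Nat.eq_zero_or_pos ℓ with rfl | hp
        · simp
        · have hq2 : x + c ≤ q := hA2.resolve_left (by omega)
          have := (ih (ℓ - 1) (by omega)).1
          rw [hlagm hp, Nat.sub_add_cancel hp] at this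
          have := this (by linarith)
          exact mul_le_mul_of_nonneg_left (min_diff _ _ _ _ (by linarith) (by linarith)) c2
      have key : d * d' * (x + c - L) ≤ d * d' * (V (i + 1) ℓ - V (i + 1) (ℓ + 1)) := by
        rw [hex, hr]; linarith
      have := le_of_mul_le_mul_left key dd
      exact ⟨fun _ => this, fun h => by linarith⟩
    · have hpos : 0 < d * d' * (V (i + 1) ℓ - V (i + 1) (ℓ + 1)) := by
        rw [hr]
        have t2 : 0 ≤
            d' * ℓ * μ₂ * (min (V i (ℓ - 1)) (V i ℓ) - min (V i ℓ) (V i (ℓ + 1))) := by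
          rcases Nat.eq_zero_or_pos ℓ with rfl | hp
          · simp
          · have hq2 : q < x + c := by
              by_contra hcon
              push Not at hcon
              exact hA ⟨by linarith, Or.inr hcon⟩
            have := (ih (ℓ - 1) (by omega)).2
            rw [hlagm hp, Nat.sub_add_cancel hp] at this
            have := this (by linarith)
            exact mul_nonneg c2 (min_diff _ _ _ _ le_rfl this.le)
        rcases lt_or_ge L x with hxL | hxL
        · have t3 := mul_nonneg c3.le
            (min_diff (V i ℓ) (V i (ℓ + 1)) (V i (ℓ + 1 + 1)) 0 le_rfl (ihB hxL).le)
          have := mul_pos c1 (by linarith : 0 < x + c)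
          linarith
        · have hq2 : q < x + c := by
            by_contra hcon
            push Not at hcon
            exact hA ⟨hxL, Or.inr hcon⟩
          have t3 : d * ((N : ℝ) - ℓ - 1) * μ₁ * (x - L) ≤ d * ((N : ℝ) - ℓ - 1) * μ₁ *
              (min (V i ℓ) (V i (ℓ + 1)) - min (V i (ℓ + 1)) (V i (ℓ + 1 + 1))) :=
            mul_le_mul_of_nonneg_left (min_diff _ _ _ _ (by linarith) (ihA hxL)) c3.le
          have s1 : N * μ₁ * (c * d) < N * μ₁ * μ₂ * (x + c) := by
            rw [← hqm]
            have := mul_lt_mul_of_pos_left hq2 c1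
            linarith
          have s2 : d * ((N : ℝ) - ℓ - 1) * μ₁ * (-c) ≤ d * ((N : ℝ) - ℓ - 1) * μ₁ * (x - L) :=
            mul_le_mul_of_nonneg_left (by linarith) c3.le
          have s3 : 0 ≤ (ℓ + 1 : ℝ) * (d * μ₁ * c) := by positivity
          linarith
      have := pos_of_mul_pos_right hpos dd.le
      refine ⟨fun h => by linarith, fun _ => this⟩

theorem stmt18
    (C₁ C₂ : ℕ) (hC₂pos : 1 ≤ C₂) (hC : C₂ < C₁)
    (μ₁ μ₂ h₀ h₁ h₂ : ℝ)
    (hμ₁ : 0 < μ₁) (hμ₂ : 0 < μ₂)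
    (hh₀ : 0 < h₀) (hh₁ : 0 < h₁) (hh₂ : 0 < h₂)
    (v : ℕ → ℕ → ℕ → ℝ) (hv : IsValue C₁ C₂ μ₁ μ₂ h₀ h₁ h₂ v)
    (hcost : h₁ / μ₁ ≤ h₂ / μ₂)
    (ℓ : ℕ) (hℓC : ℓ ≤ C₁ - 1) :
    (μ₁ < μ₂ ∧ ℓ < C₂ →
      {i : ℕ | 0 < Dv v i (C₁ - ℓ) ℓ}.Nonempty ∧
      ⌊-(h₁ / μ₁ - h₂ / μ₂) / (h₀ / (C₁ : ℝ) * (1 / μ₁ - 1 / μ₂))⌋ + 1 ≤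
        ((sInf {i : ℕ | 0 < Dv v i (C₁ - ℓ) ℓ} : ℕ) : ℤ) ∧
      ((sInf {i : ℕ | 0 < Dv v i (C₁ - ℓ) ℓ} : ℕ) : ℤ) ≤
        ⌊-(h₁ / μ₁ - h₂ / μ₂) / (h₀ / (C₁ : ℝ) * (1 / μ₁ - 1 / μ₂))⌋ + 1
          + ((C₁ - 1 : ℕ) : ℤ)) ∧
    ((μ₂ ≤ μ₁ ∨ C₂ ≤ ℓ) → ∀ i : ℕ, Dv v i (C₁ - ℓ) ℓ ≤ 0) := by
  set V : ℕ → ℕ → ℝ := fun i ℓ => v i (C₁ - ℓ) ℓ with hVdef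
  have hV : RecV C₁ C₂ μ₁ μ₂ h₀ h₁ h₂ V := recV_of hC₂pos hC hμ₁ hμ₂ hv
  have hvz := v_zero hC₂pos hμ₁ hμ₂ hv
  have hz : ∀ k m : ℕ, k + m ≤ C₁ → v 0 k m = k * (h₁ / μ₁) + gCost C₂ μ₂ h₂ m :=
    fun k m h => hvz (k + m) k m rfl h
  have hg := gCost_step (C₂ := C₂) hC₂pos hμ₂ hh₂
  have hV0 : ∀ m ≤ C₁, V 0 m = ((C₁ : ℝ) - m) * (h₁ / μ₁) + gCost C₂ μ₂ h₂ m := by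
    intro m hm
    simp only [hVdef]
    rw [hz _ _ (by omega), Nat.cast_sub hm]
  have hD0 : ∀ m < C₁, V 0 m ≤ V 0 (m + 1) := by
    intro m hm
    rw [hV0 m hm.le, hV0 (m + 1) hm]
    have := hg m
    push_cast
    linarith
  have hD0' : ∀ m < C₂, V 0 m - V 0 (m + 1) = h₁ / μ₁ - h₂ / μ₂ := by
    intro m hm
    rw [hV0 m (by omega), hV0 (m + 1) (by omega)]
    have := gCost_step_eq (h₂ := h₂) hμ₂ m hm
    push_cast
    linarith
  have hbase : ∀ m ≤ C₁, V 0 m + h₁ / μ₁ ≤ V 1 m := by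
    intro m hm
    have hk : (0 : ℝ) ≤ (C₁ : ℝ) - m := by
      have : (m : ℝ) ≤ C₁ := by exact_mod_cast hm
      linarith
    have r := hV 0 m hm
    have hd := dRate_pos hC₂pos hμ₁ hμ₂ (C₁ - m) m (by omega)
    unfold dRate at hd
    rw [Nat.cast_sub hm] at hd
    refine le_of_mul_le_mul_left ?_ hd
    rw [show (1 : ℕ) = 0 + 1 from rfl, r]
    have m1 : ((C₁ : ℝ) - m) * μ₁ * V 0 m
        ≤ ((C₁ : ℝ) - m) * μ₁ * min (V 0 m) (V 0 (m + 1)) := by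
      rcases Nat.lt_or_ge m C₁ with h | h
      · rw [min_eq_left (hD0 m h)]
      · have : m = C₁ := by omega
        subst this; simp
    have m2 : ((min m C₂ : ℕ) : ℝ) * μ₂ * (V 0 m + h₁ / μ₁) - m * h₂
        ≤ ((min m C₂ : ℕ) : ℝ) * μ₂ * min (V 0 (m - 1)) (V 0 m) := by
      rcases m with _ | n
      · simp
      · rw [Nat.add_sub_cancel, min_eq_left (hD0 n hm)]
        rw [hV0 n (by omega), hV0 (n + 1) hm]
        have h1 : 0 < min (n + 1) C₂ := by omega
        have h2 : (0 : ℝ) < ((min (n + 1) C₂ : ℕ) : ℝ) := by exact_mod_cast h1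
        have h3 : ((min (n + 1) C₂ : ℕ) : ℝ) * μ₂ *
          (((n : ℝ) + 1) * h₂ / (((min (n + 1) C₂ : ℕ) : ℝ) * μ₂)) = ((n : ℝ) + 1) * h₂ := by
          field_simp
        simp only [gCost]
        push_cast at h3 ⊢
        linarith
    have e3 : ((C₁ : ℝ) - m) * h₁ = ((C₁ : ℝ) - m) * μ₁ * (h₁ / μ₁) := by field_simp
    push_cast
    rw [e3]
    push_cast at m2
    linarith
  have hinc := V_incr hC₂pos hC hμ₁ hμ₂ hh₀ hV (h₁ / μ₁) hbase
  have hhigh := D_high hC₂pos hC hμ₁ hμ₂ hh₂ hV hinc hD0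
  have hnon := D_nonpos hC hμ₁ hμ₂ hV hhigh hD0
  have hN : (0 : ℝ) < C₁ := by exact_mod_cast (by omega : 0 < C₁)
  have hDv : ∀ i, Dv v i (C₁ - ℓ) ℓ = V i ℓ - V i (ℓ + 1) := fun i => rfl
  simp only [hDv]
  have hℓN : ℓ < C₁ := by omega
  constructor
  · rintro ⟨hlt, hl⟩
    obtain ⟨b, hb⟩ : ∃ b, b = h₁ / μ₁ - h₂ / μ₂ := ⟨_, rfl⟩
    obtain ⟨c, hc⟩ : ∃ c, c = h₀ / (C₁ : ℝ) * (1 / μ₁ - 1 / μ₂) := ⟨_, rfl⟩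
    have hb0 : b ≤ 0 := by rw [hb]; linarith
    have hc0 : 0 < c := by
      rw [hc]
      have : 1 / μ₂ < 1 / μ₁ := one_div_lt_one_div_of_lt hμ₁ hlt
      exact mul_pos (by positivity) (by linarith)
    have hlow := D_lower hC hμ₁ hμ₂ hlt hV b c hb hc hb0 hc0 (by rw [hb]; exact hD0')
    rw [← hb, ← hc] at hnon ⊢
    have hR0 : 0 ≤ -b / c := div_nonneg (by linarith) hc0.le
    obtain ⟨r, hr⟩ : ∃ r : ℕ, (r : ℤ) = ⌊-b / c⌋ := ⟨_, Int.toNat_of_nonneg (Int.floor_nonneg.2 hR0)⟩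
    have hr1 : -b / c < (r : ℝ) + 1 := by
      have := Int.lt_floor_add_one (-b / c)
      rw [← hr] at this
      exact_mod_cast this
    have hmem : r + 1 + (C₁ - 1) ∈ {i : ℕ | 0 < V i ℓ - V i (ℓ + 1)} := by
      refine (hlow _ ℓ hl).2 ?_
      have h1 : -b < ((r : ℝ) + 1) * c := (div_lt_iff₀ hc0).1 hr1
      have h2 : lag C₁ μ₁ μ₂ c ℓ ≤ c * ((C₁ : ℝ) - 1) := by
        unfold lag
        rw [div_le_iff₀ hμ₂, mul_assoc]
        apply mul_le_mul_of_nonneg_left _ hc0.le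
        have hk : (0 : ℝ) ≤ (C₁ : ℝ) - ℓ - 1 := by
          have : ((ℓ + 1 : ℕ) : ℝ) ≤ C₁ := by exact_mod_cast hℓN
          push_cast at this
          linarith
        have := mul_le_mul_of_nonneg_left hlt.le hk
        linarith
      push_cast [Nat.cast_sub (by omega : 1 ≤ C₁)]
      linarith
    refine ⟨⟨_, hmem⟩, ?_, ?_⟩
    · have hs := Nat.sInf_mem ⟨_, hmem⟩
      obtain ⟨s, hs'⟩ : ∃ s, s = sInf {i : ℕ | 0 < V i ℓ - V i (ℓ + 1)} := ⟨_, rfl⟩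
      rw [← hs'] at hs ⊢
      rw [Set.mem_ofPred_eq] at hs
      by_contra hcon
      push Not at hcon
      have hle : (s : ℤ) ≤ ⌊-b / c⌋ := by omega
      have hle' : (s : ℝ) ≤ -b / c := by
        have := Int.le_floor.1 hle
        exact_mod_cast this
      have hsc : (s : ℝ) * c ≤ -b := (le_div_iff₀ hc0).1 hle'
      have := hnon s (fun j hj => by
        have : (j : ℝ) * c ≤ s * c := mul_le_mul_of_nonneg_right (by exact_mod_cast hj) hc0.le
        linarith) ℓ hℓN
      linarith
    · have := Nat.sInf_le hmem
      rw [← hr]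
      exact_mod_cast this
  · rintro (h | h) i
    · refine sub_nonpos.2 (hnon i (fun j _ => ?_) ℓ hℓN)
      have h1 : 1 / μ₁ ≤ 1 / μ₂ := one_div_le_one_div_of_le hμ₂ h
      have h2 : h₀ / (C₁ : ℝ) * (1 / μ₁ - 1 / μ₂) ≤ 0 :=
        mul_nonpos_of_nonneg_of_nonpos (by positivity) (by linarith)
      have := mul_nonpos_of_nonpos_of_nonneg h2 (Nat.cast_nonneg (α := ℝ) j)
      linarith
    · exact sub_nonpos.2 (hhigh i ℓ h hℓN)
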